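/- Let n ∈ ℕ, fix x₀ ∈ ℝ^n with ‖x₀‖ = 1, and let c_g be a positive constant with the order-statistics property below. Then for every α > 0, every C > 0, and every ε with 0 < ε < min(1, c_g² ln 2), one has β̊^max_{ε,α,C} < ε/(2c_g² ln(2c_g²/ε)). -/

import Mathlib

open MeasureTheory ProbabilityTheory Real

/-- The canonical probability space of `m` i.i.d. standard Gaussian random variables. -/
noncomputable def stdGaussianPi (m : ℕ) : Measure (Fin m → ℝ) :=
  Measure.pi fun _ => gaussianReal 0 1

/-- The law of an `m × n` Gaussian random matrix with i.i.d. `N(0,1)` entries. -/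
noncomputable def gaussianMatrix (m n : ℕ) : Measure (Fin m → Fin n → ℝ) :=
  Measure.pi fun _ => Measure.pi fun _ => gaussianReal 0 1

/-- `absOrd y j = |Y_(j+1)|`: the `(j+1)`-st largest among `|y 0|, …, |y (m-1)|`. -/
noncomputable def absOrd {m : ℕ} (y : Fin m → ℝ) (j : Fin m) : ℝ :=
  |y (Tuple.sort (fun i => -|y i|) j)|

/-- `c` has the order-statistics property: `c √(ln(2m/(j+1))) ≤ E|Y_(j+1)|` for
all `m` and all `j+1 ≤ m/2`. -/
def cgProperty (c : ℝ) : Prop :=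
  ∀ (m : ℕ) (j : Fin m), 2 * ((j : ℕ) + 1) ≤ m →
    c * Real.sqrt (Real.log (2 * m / ((j : ℕ) + 1))) ≤ ∫ y, absOrd y j ∂(stdGaussianPi m)

/-- `‖A_T x‖²`. -/
noncomputable def subNormSq {m n : ℕ} (A : Fin m → Fin n → ℝ) (x : Fin n → ℝ)
    (T : Finset (Fin m)) : ℝ :=
  ∑ i ∈ T, (∑ j, A i j * x j) ^ 2

/-- The event `Ω̊_{ε,β}`. -/
def omegaRingEvent (m n : ℕ) (x₀ : Fin n → ℝ) (ε β : ℝ) : Set (Fin m → Fin n → ℝ) :=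
  {A | ∀ T : Finset (Fin m), (Tᶜ.card : ℝ) ≤ β * m →
    |(1 / (m : ℝ)) * subNormSq A x₀ T - 1| ≤ ε}

/-- `β̊^max_{ε,α,C}`: the supremum of all `β ∈ (0,1)` such that
`P(Ω̊_{ε,β}) ≥ 1 − C e^{−α(ε²/4−ε³/6)m}` for all sufficiently large `m`
(with `sSup ∅ = 0` in `ℝ`). -/
noncomputable def betaRingMaxC (n : ℕ) (x₀ : Fin n → ℝ) (ε α C : ℝ) : ℝ :=
  sSup {β : ℝ | 0 < β ∧ β < 1 ∧ ∃ M : ℕ, ∀ m : ℕ, M ≤ m →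
    ENNReal.ofReal (1 - C * Real.exp (-α * (ε ^ 2 / 4 - ε ^ 3 / 6) * m)) ≤
      gaussianMatrix m n (omegaRingEvent m n x₀ ε β)}

instance isProbabilityMeasure_stdGaussianPi (m : ℕ) : IsProbabilityMeasure (stdGaussianPi m) := by
  unfold stdGaussianPi; infer_instance

/-- A linear form with unit coefficient vector maps the standard Gaussian to `N(0,1)`. -/
theorem measurePreserving_sum_mul_gaussian {n : ℕ} (x : Fin n → ℝ) (hx : ∑ j, x j ^ 2 = 1) :
    MeasurePreserving (fun a : Fin n → ℝ => ∑ j, a j * x j)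
      (Measure.pi fun _ => gaussianReal 0 1) (gaussianReal 0 1) := by
  refine ⟨by fun_prop, ?_⟩
  have : IsProbabilityMeasure ((Measure.pi fun _ : Fin n => gaussianReal 0 1).map
      (fun a => ∑ j, a j * x j)) :=
    Measure.isProbabilityMeasure_map (by fun_prop : Measurable _).aemeasurable
  apply Measure.ext_of_charFun
  have hind : iIndepFun (fun (j : Fin n) (a : Fin n → ℝ) => a j * x j)
      (Measure.pi fun _ : Fin n => gaussianReal 0 1) :=
    iIndepFun_pi (X := fun j y => y * x j) (by fun_prop)
  rw [hind.charFun_map_fun_sum_eq_prod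
    fun j => (by fun_prop : Measurable fun a : Fin n → ℝ => a j * x j).aemeasurable]
  have hmap (j : Fin n) : (Measure.pi fun _ : Fin n => gaussianReal 0 1).map
      (fun a => a j * x j) = (gaussianReal 0 1).map (fun y => y * x j) := by
    conv_rhs => rw [← (measurePreserving_eval (fun _ : Fin n => gaussianReal 0 1) j).map_eq]
    rw [Measure.map_map (by fun_prop) (by fun_prop)]
    rfl
  ext s
  simp only [Finset.prod_apply, hmap, gaussianReal_map_mul_const, charFun_gaussianReal]
  rw [← Complex.exp_sum]
  have h : ∑ j, (x j : ℂ) ^ 2 = 1 := by exact_mod_cast hx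
  congr 1
  simp [← Finset.sum_div, ← Finset.sum_mul, h]

theorem measurePreserving_mulVec_gaussianMatrix {m n : ℕ} (x : Fin n → ℝ) (hx : ∑ j, x j ^ 2 = 1) :
    MeasurePreserving (fun (A : Fin m → Fin n → ℝ) i => ∑ j, A i j * x j)
      (gaussianMatrix m n) (stdGaussianPi m) :=
  measurePreserving_pi _ _ fun _ => measurePreserving_sum_mul_gaussian x hx

/-- One-sided weak law of large numbers for bounded functions of i.i.d. Gaussians. -/
theorem tendsto_stdGaussianPi_sum_ge {f : ℝ → ℝ} (hf : Measurable f) {K : ℝ}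
    (hK : ∀ x, |f x| ≤ K) {b : ℝ} (hb : ∫ x, f x ∂(gaussianReal 0 1) < b) :
    Filter.Tendsto (fun m : ℕ => (stdGaussianPi m).real {y | b * m ≤ ∑ i, f (y i)})
      Filter.atTop (nhds 0) := by
  set E := ∫ x, f x ∂(gaussianReal 0 1)
  set V := variance f (gaussianReal 0 1)
  have hL : MemLp f 2 (gaussianReal 0 1) :=
    MemLp.of_bound hf.aestronglyMeasurable K (ae_of_all _ hK)
  have hV : 0 ≤ V := variance_nonneg _ _
  have hlim : Filter.Tendsto (fun m : ℕ => V / (b - E) ^ 2 / (m : ℝ)) Filter.atTop (nhds 0) :=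
    tendsto_const_div_atTop_nhds_zero_nat _
  refine squeeze_zero' (Filter.Eventually.of_forall fun m => measureReal_nonneg) ?_ hlim
  filter_upwards [Filter.eventually_gt_atTop 0] with m hm
  have hm' : (0 : ℝ) < m := by exact_mod_cast hm
  have hLi (i : Fin m) : MemLp (fun y : Fin m → ℝ => f (y i)) 2 (stdGaussianPi m) :=
    hL.comp_measurePreserving (measurePreserving_eval (fun _ : Fin m => gaussianReal 0 1) i)
  have hS : MemLp (∑ i, fun y : Fin m → ℝ => f (y i)) 2 (stdGaussianPi m) :=
    memLp_finsetSum' _ fun i _ => hLi i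
  have hmean : (stdGaussianPi m)[∑ i, fun y : Fin m → ℝ => f (y i)] = m * E := by
    simp only [Finset.sum_apply]
    rw [integral_finsetSum _ fun i _ => (hLi i).integrable (by norm_num)]
    have (i : Fin m) : ∫ y, f (y i) ∂(stdGaussianPi m) = E :=
      integral_comp_eval hf.aestronglyMeasurable
    simp [this]
  have hvar : variance (∑ i, fun y : Fin m → ℝ => f (y i)) (stdGaussianPi m) = m * V := by
    unfold stdGaussianPi
    rw [variance_sum_pi (X := fun _ => f) fun _ => hL]
    simp [V]
  have hc : 0 < (b - E) * m := mul_pos (by linarith) hm'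
  have h := meas_ge_le_variance_div_sq hS hc
  rw [hmean, hvar] at h
  have h2 : (stdGaussianPi m).real {y | b * m ≤ ∑ i, f (y i)} ≤ m * V / ((b - E) * m) ^ 2 := by
    refine ENNReal.toReal_le_of_le_ofReal (by positivity) (le_trans (measure_mono ?_) h)
    intro y hy
    simp only [Set.mem_ofPred_eq, Finset.sum_apply] at hy ⊢
    exact le_trans (by linarith) (le_abs_self _)
  refine h2.trans (le_of_eq ?_)
  have : b - E ≠ 0 := by linarith
  field_simp

theorem gaussianPDFReal_zero_one (x : ℝ) :
    gaussianPDFReal 0 1 x = (√(2 * π))⁻¹ * rexp (-x ^ 2 / 2) := by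
  simp [gaussianPDFReal_def]

theorem hasDerivAt_gaussianPDFReal_zero_one (x : ℝ) :
    HasDerivAt (gaussianPDFReal 0 1) (-x * gaussianPDFReal 0 1 x) x := by
  have h : HasDerivAt (fun x : ℝ => (√(2 * π))⁻¹ * rexp (-x ^ 2 / 2))
      ((√(2 * π))⁻¹ * (rexp (-x ^ 2 / 2) * (-(2 * x) / 2))) x := by
    have := (((hasDerivAt_pow 2 x).neg.div_const 2).exp).const_mul (√(2 * π))⁻¹
    simpa using this
  rw [show gaussianPDFReal 0 1 = fun x : ℝ => (√(2 * π))⁻¹ * rexp (-x ^ 2 / 2) from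
    funext gaussianPDFReal_zero_one]
  convert! h using 1
  ring

theorem continuous_gaussianPDFReal_zero_one : Continuous (gaussianPDFReal 0 1) :=
  continuous_iff_continuousAt.2 fun x => (hasDerivAt_gaussianPDFReal_zero_one x).continuousAt

theorem tendsto_gaussianPDFReal_zero_one_atTop :
    Filter.Tendsto (gaussianPDFReal 0 1) Filter.atTop (nhds 0) := by
  rw [show gaussianPDFReal 0 1 = fun x : ℝ => (√(2 * π))⁻¹ * rexp (-x ^ 2 / 2) from
    funext gaussianPDFReal_zero_one]
  have h : Filter.Tendsto (fun x : ℝ => x ^ 2 / 2) Filter.atTop Filter.atTop :=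
    (Filter.tendsto_pow_atTop two_ne_zero).atTop_div_const two_pos
  have := (Real.tendsto_exp_neg_atTop_nhds_zero.comp h).const_mul (√(2 * π))⁻¹
  simpa [Function.comp_def, neg_div] using this

/-- Mills' upper bound for a one-sided Gaussian tail. -/
theorem gaussianReal_Ioi_le {t : ℝ} (ht : 0 < t) :
    (gaussianReal 0 1).real (Set.Ioi t) ≤ gaussianPDFReal 0 1 t / t := by
  have hderiv (x : ℝ) : HasDerivAt (fun x => -gaussianPDFReal 0 1 x)
      (x * gaussianPDFReal 0 1 x) x := by
    convert! (hasDerivAt_gaussianPDFReal_zero_one x).neg using 1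
    ring
  have hpos : ∀ x ∈ Set.Ioi t, 0 ≤ x * gaussianPDFReal 0 1 x := fun x hx =>
    mul_nonneg (ht.trans hx).le (gaussianPDFReal_nonneg _ _ _)
  have hlim : Filter.Tendsto (fun x => -gaussianPDFReal 0 1 x) Filter.atTop (nhds 0) := by
    simpa using tendsto_gaussianPDFReal_zero_one_atTop.neg
  have hint := integrableOn_Ioi_deriv_of_nonneg' (fun x _ => hderiv x) hpos hlim
  have heq := integral_Ioi_of_hasDerivAt_of_nonneg' (fun x _ => hderiv x) hpos hlim
  rw [measureReal_def, gaussianReal_apply_eq_integral _ one_ne_zero, ENNReal.toReal_ofReal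
    (integral_nonneg fun x => gaussianPDFReal_nonneg _ _ _), le_div_iff₀ ht, mul_comm,
    ← integral_const_mul]
  calc ∫ x in Set.Ioi t, t * gaussianPDFReal 0 1 x
      ≤ ∫ x in Set.Ioi t, x * gaussianPDFReal 0 1 x :=
        setIntegral_mono_on ((integrable_gaussianPDFReal 0 1).const_mul t).integrableOn hint
          measurableSet_Ioi fun x hx =>
            mul_le_mul_of_nonneg_right (le_of_lt hx) (gaussianPDFReal_nonneg _ _ _)
    _ = gaussianPDFReal 0 1 t := by rw [heq]; ring

theorem gaussianReal_abs_gt_le {t : ℝ} (ht : 0 < t) :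
    (gaussianReal 0 1).real {x | t < |x|} ≤ 2 * gaussianPDFReal 0 1 t / t := by
  have hneg : (gaussianReal 0 1).real (Set.Iio (-t)) = (gaussianReal 0 1).real (Set.Ioi t) := by
    have h : (gaussianReal 0 1).map (fun x => -x) = gaussianReal 0 1 := by
      simp [gaussianReal_map_neg]
    conv_lhs => rw [← h]
    rw [map_measureReal_apply (by fun_prop) measurableSet_Iio]
    congr 1
    ext x
    simp
  have hset : {x : ℝ | t < |x|} = Set.Iio (-t) ∪ Set.Ioi t := by
    ext x
    simp only [Set.mem_ofPred_eq, Set.mem_union, Set.mem_Iio, Set.mem_Ioi, lt_abs]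
    constructor <;> rintro (h | h) <;> first | (left; linarith) | (right; linarith)
  rw [hset]
  have := measureReal_union_le (μ := gaussianReal 0 1) (Set.Iio (-t)) (Set.Ioi t)
  have h2 := gaussianReal_Ioi_le ht
  rw [hneg] at this
  calc _ ≤ _ := this
    _ ≤ 2 * (gaussianPDFReal 0 1 t / t) := by linarith
    _ = _ := by ring

theorem integral_indicator_abs_le_gaussianReal (g : ℝ → ℝ) {t : ℝ} (ht : 0 ≤ t) :
    ∫ x, {x : ℝ | |x| ≤ t}.indicator g x ∂(gaussianReal 0 1) =
      ∫ x in (-t)..t, g x * gaussianPDFReal 0 1 x := by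
  have hset : {x : ℝ | |x| ≤ t} = Set.Icc (-t) t := by
    ext x; simp [abs_le]
  rw [integral_gaussianReal_eq_integral_smul one_ne_zero,
    intervalIntegral.integral_of_le (by linarith), ← integral_Icc_eq_integral_Ioc,
    ← integral_indicator measurableSet_Icc, hset]
  congr 1
  ext x
  by_cases hx : x ∈ Set.Icc (-t) t <;> simp [hx, mul_comm]

/-- The truncated second moment of a standard Gaussian. -/
theorem integral_sq_indicator_gaussianReal_le {t : ℝ} (ht : 0 ≤ t) :
    ∫ x, {x : ℝ | |x| ≤ t}.indicator (fun x => x ^ 2) x ∂(gaussianReal 0 1) ≤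
      1 - 2 * t * gaussianPDFReal 0 1 t := by
  have hc := continuous_gaussianPDFReal_zero_one
  rw [integral_indicator_abs_le_gaussianReal _ ht]
  have hd (x : ℝ) : HasDerivAt (fun x => -(x * gaussianPDFReal 0 1 x))
      (x ^ 2 * gaussianPDFReal 0 1 x - gaussianPDFReal 0 1 x) x := by
    convert! ((hasDerivAt_id x).mul (hasDerivAt_gaussianPDFReal_zero_one x)).neg using 1
    simp only [id]
    ring
  have h1 : IntervalIntegrable (fun x => x ^ 2 * gaussianPDFReal 0 1 x) volume (-t) t :=
    (by fun_prop : Continuous _).intervalIntegrable _ _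
  have h2 : IntervalIntegrable (gaussianPDFReal 0 1) volume (-t) t := hc.intervalIntegrable _ _
  have h := intervalIntegral.integral_eq_sub_of_hasDerivAt (fun x _ => hd x) (h1.sub h2)
  rw [intervalIntegral.integral_sub h1 h2] at h
  have heven : gaussianPDFReal 0 1 (-t) = gaussianPDFReal 0 1 t := by
    simp [gaussianPDFReal_zero_one]
  have hle : ∫ x in (-t)..t, gaussianPDFReal 0 1 x ≤ 1 := by
    rw [intervalIntegral.integral_of_le (by linarith)]
    exact (setIntegral_le_integral (integrable_gaussianPDFReal 0 1)
      (ae_of_all _ (gaussianPDFReal_nonneg 0 1))).trans_eq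
        (integral_gaussianPDFReal_eq_one 0 one_ne_zero)
  rw [heven] at h
  linarith

theorem gaussianReal_abs_gt_lt_half : (gaussianReal 0 1).real {x | (4 / 5 : ℝ) < |x|} < 1 / 2 := by
  have hmeas : MeasurableSet {x : ℝ | |x| ≤ 4 / 5} :=
    measurableSet_le (by fun_prop) (by fun_prop)
  have hcompl : {x : ℝ | (4 / 5 : ℝ) < |x|} = {x : ℝ | |x| ≤ 4 / 5}ᶜ := by
    ext x; simp
  rw [hcompl, probReal_compl_eq_one_sub hmeas]
  have h1 : (gaussianReal 0 1).real {x : ℝ | |x| ≤ 4 / 5} =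
      ∫ x in (-(4 / 5 : ℝ))..(4 / 5), gaussianPDFReal 0 1 x := by
    have := integral_indicator_abs_le_gaussianReal (fun _ => 1) (t := 4 / 5) (by norm_num)
    rw [integral_indicator hmeas] at this
    simpa using this
  have hlow : ∫ x in (-(4 / 5 : ℝ))..(4 / 5), (√(2 * π))⁻¹ * (1 - x ^ 2 / 2) ≤
      ∫ x in (-(4 / 5 : ℝ))..(4 / 5), gaussianPDFReal 0 1 x := by
    refine intervalIntegral.integral_mono_on (by norm_num)
      ((by fun_prop : Continuous _).intervalIntegrable _ _)
      (continuous_gaussianPDFReal_zero_one.intervalIntegrable _ _) fun x _ => ?_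
    rw [gaussianPDFReal_zero_one]
    gcongr
    linarith [Real.add_one_le_exp (-x ^ 2 / 2)]
  have hval : ∫ x in (-(4 / 5 : ℝ))..(4 / 5), (√(2 * π))⁻¹ * (1 - x ^ 2 / 2) =
      (√(2 * π))⁻¹ * (536 / 375) := by
    rw [intervalIntegral.integral_const_mul]
    congr 1
    rw [intervalIntegral.integral_sub (by simp) ((by fun_prop : Continuous _).intervalIntegrable _ _),
      intervalIntegral.integral_div, integral_pow]
    norm_num
  have hsqrt : √(2 * π) < 1072 / 375 := by
    rw [Real.sqrt_lt' (by norm_num)]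
    linarith [Real.pi_lt_d2]
  have hpos : 0 < √(2 * π) := by positivity
  have : 1 / 2 < (√(2 * π))⁻¹ * (536 / 375) := by
    rw [inv_mul_eq_div, lt_div_iff₀ hpos]
    linarith
  rw [h1]
  linarith

theorem card_absOrd_le {m : ℕ} (y : Fin m → ℝ) (j : Fin m) :
    (j : ℕ) + 1 ≤ (Finset.univ.filter fun i => absOrd y j ≤ |y i|).card := by
  set σ := Tuple.sort fun i => -|y i|
  have h : (Finset.Iic j).map σ.toEmbedding ⊆
      Finset.univ.filter fun i => absOrd y j ≤ |y i| := by
    intro i hi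
    obtain ⟨k, hk, rfl⟩ := Finset.mem_map.1 hi
    have := Tuple.monotone_sort (fun i => -|y i|) (Finset.mem_Iic.1 hk)
    simp only [Finset.mem_filter, Finset.mem_univ, true_and]
    exact neg_le_neg_iff.1 this
  simpa using Finset.card_le_card h

theorem absOrd_nonneg {m : ℕ} (y : Fin m → ℝ) (j : Fin m) : 0 ≤ absOrd y j := abs_nonneg _

theorem absOrd_le_threshold_add {k : ℕ} (y : Fin (2 * k) → ℝ) (j : Fin (2 * k))
    (hj : (j : ℕ) + 1 = k) {s δ : ℝ} (hs : 0 ≤ s) (hδ : 0 < δ) :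
    absOrd y j ≤ s + δ / (2 * k) * ∑ i, y i ^ 2 + 1 / (2 * δ) *
      {y : Fin (2 * k) → ℝ | 1 / 2 * ((2 * k : ℕ) : ℝ) ≤
        ∑ i, {x : ℝ | s < |x|}.indicator 1 (y i)}.indicator 1 y := by
  set u := absOrd y j with hu
  have hu0 : 0 ≤ u := absOrd_nonneg y j
  have hk : (0 : ℝ) < k := by
    have : 0 < k := by omega
    exact_mod_cast this
  have hsum : 0 ≤ ∑ i, y i ^ 2 := Finset.sum_nonneg fun i _ => sq_nonneg _
  have hcard := card_absOrd_le y j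
  rw [hj, ← hu] at hcard
  have hcard' : (k : ℝ) ≤ ((Finset.univ.filter fun i => u ≤ |y i|).card : ℝ) := by
    exact_mod_cast hcard
  by_cases hsu : u ≤ s
  · have h1 : 0 ≤ δ / (2 * k) * ∑ i, y i ^ 2 := by positivity
    have h2 : 0 ≤ 1 / (2 * δ) * {y : Fin (2 * k) → ℝ | 1 / 2 * ((2 * k : ℕ) : ℝ) ≤
        ∑ i, {x : ℝ | s < |x|}.indicator 1 (y i)}.indicator 1 y :=
      mul_nonneg (by positivity) (Set.indicator_nonneg (fun _ _ => zero_le_one) _)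
    linarith
  · push Not at hsu
    have hmem : y ∈ {y : Fin (2 * k) → ℝ | 1 / 2 * ((2 * k : ℕ) : ℝ) ≤
        ∑ i, {x : ℝ | s < |x|}.indicator 1 (y i)} := by
      simp only [Set.mem_ofPred_eq]
      calc 1 / 2 * ((2 * k : ℕ) : ℝ) = k := by push_cast; ring
        _ ≤ _ := hcard'
        _ = ∑ i, {x : ℝ | u ≤ |x|}.indicator 1 (y i) := by
          rw [Finset.card_filter]
          push_cast
          simp [Set.indicator_apply]
        _ ≤ _ := Finset.sum_le_sum fun i _ =>
          Set.indicator_le_indicator_of_subset (fun x hx => hsu.trans_le hx)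
            (fun _ => zero_le_one) _
    rw [Set.indicator_of_mem hmem]
    have hsq : k * u ^ 2 ≤ ∑ i, y i ^ 2 := by
      calc k * u ^ 2 ≤ ((Finset.univ.filter fun i => u ≤ |y i|).card : ℝ) * u ^ 2 := by gcongr
        _ = ∑ i ∈ Finset.univ.filter fun i => u ≤ |y i|, u ^ 2 := by simp
        _ ≤ ∑ i ∈ Finset.univ.filter fun i => u ≤ |y i|, y i ^ 2 :=
          Finset.sum_le_sum fun i hi => by
            rw [← sq_abs (y i)]
            exact pow_le_pow_left₀ hu0 (Finset.mem_filter.1 hi).2 2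
        _ ≤ _ := Finset.sum_le_sum_of_subset_of_nonneg (Finset.subset_univ _)
          fun i _ _ => sq_nonneg _
    have h3 : δ / 2 * u ^ 2 ≤ δ / (2 * k) * ∑ i, y i ^ 2 := by
      calc δ / 2 * u ^ 2 = δ / (2 * k) * (k * u ^ 2) := by field_simp
        _ ≤ _ := by gcongr
    have h4 : u ≤ δ / 2 * u ^ 2 + 1 / (2 * δ) := by
      have : δ / 2 * u ^ 2 + 1 / (2 * δ) - u = (δ * u - 1) ^ 2 / (2 * δ) := by
        field_simp; ring
      have h5 : 0 ≤ (δ * u - 1) ^ 2 / (2 * δ) := by positivity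
      linarith
    simp only [Pi.one_apply, mul_one]
    linarith

theorem integral_sq_gaussianReal : ∫ x, x ^ 2 ∂(gaussianReal 0 1) = 1 := by
  have h := variance_fun_id_gaussianReal (μ := 0) (v := 1)
  rw [variance_eq_integral (by fun_prop)] at h
  simpa using h

theorem integral_absOrd_le {k : ℕ} (j : Fin (2 * k)) (hj : (j : ℕ) + 1 = k) {s δ : ℝ}
    (hs : 0 ≤ s) (hδ : 0 < δ) :
    ∫ y, absOrd y j ∂(stdGaussianPi (2 * k)) ≤ s + δ + 1 / (2 * δ) *
      (stdGaussianPi (2 * k)).real {y | 1 / 2 * ((2 * k : ℕ) : ℝ) ≤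
        ∑ i, {x : ℝ | s < |x|}.indicator 1 (y i)} := by
  have hk : (k : ℝ) ≠ 0 := by
    have : k ≠ 0 := by omega
    exact_mod_cast this
  set S : Set (Fin (2 * k) → ℝ) := {y | 1 / 2 * ((2 * k : ℕ) : ℝ) ≤
    ∑ i, {x : ℝ | s < |x|}.indicator 1 (y i)}
  have hSm : MeasurableSet S := by
    refine measurableSet_le measurable_const (Finset.measurable_sum _ fun i _ => ?_)
    exact (measurable_one.indicator (measurableSet_lt measurable_const measurable_abs)).comp
      (measurable_pi_apply i)
  have hsqint : Integrable (fun x : ℝ => x ^ 2) (gaussianReal 0 1) :=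
    (memLp_id_gaussianReal' 2 (by norm_num)).integrable_sq
  have hi (i : Fin (2 * k)) :
      Integrable (fun y : Fin (2 * k) → ℝ => y i ^ 2) (stdGaussianPi (2 * k)) :=
    (measurePreserving_eval (fun _ => gaussianReal 0 1) i).integrable_comp_of_integrable hsqint
  have h1 : Integrable (fun y : Fin (2 * k) → ℝ => δ / (2 * k) * ∑ i, y i ^ 2)
      (stdGaussianPi (2 * k)) := (integrable_finsetSum _ fun i _ => hi i).const_mul _
  have h2 : Integrable (fun y => 1 / (2 * δ) * S.indicator 1 y) (stdGaussianPi (2 * k)) :=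
    ((integrable_const (1 : ℝ)).indicator hSm).const_mul _
  have h3 : Integrable (fun y : Fin (2 * k) → ℝ => s + δ / (2 * k) * ∑ i, y i ^ 2)
      (stdGaussianPi (2 * k)) := (integrable_const s).add h1
  refine (integral_mono_of_nonneg (ae_of_all _ fun y => absOrd_nonneg y j)
    (h3.add h2)
    (ae_of_all _ fun y => absOrd_le_threshold_add y j hj hs hδ)).trans_eq ?_
  have e1 : ∫ y, s + δ / (2 * k) * ∑ i, y i ^ 2 ∂(stdGaussianPi (2 * k)) = s + δ := by
    rw [integral_add (integrable_const s) h1, integral_const_mul,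
      integral_finsetSum _ fun i _ => hi i]
    have (i : Fin (2 * k)) : ∫ y, y i ^ 2 ∂(stdGaussianPi (2 * k)) = 1 :=
      (integral_comp_eval (μ := fun _ : Fin (2 * k) => gaussianReal 0 1) (i := i)
        (f := fun x : ℝ => x ^ 2) hsqint.aestronglyMeasurable).trans integral_sq_gaussianReal
    simp only [this]
    simp
    field_simp
  rw [integral_add' h3 h2, e1, integral_const_mul,
    integral_indicator_one hSm]

/-- The order-statistics property, tested at the median, bounds the constant. -/
theorem cgProperty.sq_mul_log_four_le {c : ℝ} (hc : 0 < c) (h : cgProperty c) :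
    c ^ 2 * Real.log 4 ≤ (4 / 5) ^ 2 := by
  set P : ℕ → ℝ := fun m => (stdGaussianPi m).real {y | 1 / 2 * (m : ℝ) ≤
    ∑ i, {x : ℝ | (4 / 5 : ℝ) < |x|}.indicator 1 (y i)}
  have hmeas : MeasurableSet {x : ℝ | (4 / 5 : ℝ) < |x|} :=
    measurableSet_lt measurable_const measurable_abs
  have hP : Filter.Tendsto P Filter.atTop (nhds 0) := by
    refine tendsto_stdGaussianPi_sum_ge (f := {x : ℝ | (4 / 5 : ℝ) < |x|}.indicator 1)
      (measurable_one.indicator hmeas) (K := 1) (fun x => ?_) ?_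
    · by_cases hx : x ∈ {x : ℝ | (4 / 5 : ℝ) < |x|} <;> simp [hx]
    · rw [integral_indicator_one hmeas]
      exact gaussianReal_abs_gt_lt_half
  have key : c * √(Real.log 4) ≤ 4 / 5 := by
    refine le_of_forall_pos_le_add fun δ hδ => ?_
    have hlim : Filter.Tendsto (fun k : ℕ => 4 / 5 + δ + 1 / (2 * δ) * P (2 * k))
        Filter.atTop (nhds (4 / 5 + δ)) := by
      have h2 : Filter.Tendsto (fun k : ℕ => 2 * k) Filter.atTop Filter.atTop :=
        Filter.tendsto_id.const_mul_atTop' two_pos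
      simpa using ((hP.comp h2).const_mul (1 / (2 * δ))).const_add (4 / 5 + δ)
    refine ge_of_tendsto hlim ?_
    filter_upwards [Filter.eventually_gt_atTop 0] with k hk
    have hj : k - 1 + 1 = k := Nat.sub_add_cancel hk
    have h1 := h (2 * k) ⟨k - 1, by omega⟩ (by simp only; omega)
    have h2 := integral_absOrd_le (k := k) ⟨k - 1, by omega⟩ hj (s := 4 / 5) (by norm_num) hδ
    have h3 : (2 * ((2 * k : ℕ) : ℝ) / (((k - 1 : ℕ) : ℝ) + 1)) = 4 := by
      have : ((k - 1 : ℕ) : ℝ) + 1 = k := by exact_mod_cast hj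
      rw [this]
      have : (k : ℝ) ≠ 0 := by exact_mod_cast hk.ne'
      push_cast
      field_simp
      norm_num
    simp only [h3] at h1
    exact h1.trans h2
  have hlog : 0 ≤ Real.log 4 := Real.log_nonneg (by norm_num)
  calc c ^ 2 * Real.log 4 = (c * √(Real.log 4)) ^ 2 := by rw [mul_pow, Real.sq_sqrt hlog]
    _ ≤ _ := pow_le_pow_left₀ (by positivity) key 2

/-- There is a truncation level `t` such that `P(|Y| > t)` lies below the claimed bound while the
Gaussian second moment beyond `t` exceeds `ε`. -/
theorem exists_threshold {c ε : ℝ} (hc : 0 < c) (hc4 : c ^ 2 * Real.log 4 ≤ (4 / 5) ^ 2)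
    (hε0 : 0 < ε) (hε : ε < c ^ 2 * Real.log 2) :
    ∃ t : ℝ, 0 < t ∧
      (gaussianReal 0 1).real {x | t < |x|} < ε / (2 * c ^ 2 * Real.log (2 * c ^ 2 / ε)) ∧
      ∫ x, {x : ℝ | |x| ≤ t}.indicator (fun x => x ^ 2) x ∂(gaussianReal 0 1) < 1 - ε := by
  set L := Real.log (2 * c ^ 2 / ε) with hL
  have hc2 : 0 < c ^ 2 := by positivity
  have hratio : 0 < 2 * c ^ 2 / ε := by positivity
  have hL1 : 1 < L := by
    rw [hL, Real.lt_log_iff_exp_lt hratio, lt_div_iff₀ hε0]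
    have h1 := Real.exp_one_lt_d9
    have h2 := Real.log_two_lt_d9
    nlinarith [mul_lt_mul_of_pos_left h2 hc2]
  have hlogL : 0 < Real.log L := Real.log_pos hL1
  have hL0 : 0 < L := by linarith
  set a := ε / (2 * c ^ 2) with ha
  have ha0 : 0 < a := by positivity
  have hεa : ε = 2 * c ^ 2 * a := by rw [ha]; field_simp
  have hexpL : rexp (-L) = a := by
    rw [Real.exp_neg, hL, Real.exp_log hratio, ha, inv_div]
  set t := √(2 * L + Real.log L) with ht
  have hpos : 0 < 2 * L + Real.log L := by linarith
  have ht0 : 0 < t := Real.sqrt_pos.2 hpos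
  have hq0 : 0 < √L := Real.sqrt_pos.2 hL0
  have hw0 : 0 < √2 := by positivity
  have hp0 : 0 < √π := Real.sqrt_pos.2 Real.pi_pos
  have hqq : √L * √L = L := Real.mul_self_sqrt hL0.le
  have hww : √2 * √2 = 2 := Real.mul_self_sqrt zero_le_two
  have htge : √2 * √L ≤ t := by
    rw [← Real.sqrt_mul zero_le_two]
    exact Real.sqrt_le_sqrt (by linarith)
  have hφ : gaussianPDFReal 0 1 t = a / (√2 * √π * √L) := by
    rw [gaussianPDFReal_zero_one, Real.sq_sqrt hpos.le,
      show -(2 * L + Real.log L) / 2 = -L + -(Real.log L / 2) by ring, Real.exp_add, hexpL,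
      Real.exp_neg, Real.exp_half, Real.exp_log hL0, Real.sqrt_mul zero_le_two]
    field_simp
  have hpi1 : 1 < √π := by
    rw [Real.lt_sqrt zero_le_one]
    linarith [Real.pi_gt_three]
  have hpi2 : √π < 9 / 5 := by
    rw [Real.sqrt_lt' (by norm_num)]
    linarith [Real.pi_lt_d2]
  refine ⟨t, ht0, (gaussianReal_abs_gt_le ht0).trans_lt ?_,
    (integral_sq_indicator_gaussianReal_le ht0.le).trans_lt ?_⟩
  · rw [hφ]
    calc 2 * (a / (√2 * √π * √L)) / t ≤ 2 * (a / (√2 * √π * √L)) / (√2 * √L) := by gcongr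
      _ = 2 * a / ((√2 * √2) * (√L * √L) * √π) := by field_simp
      _ = a / (L * √π) := by rw [hww, hqq]; field_simp
      _ < a / L := by
        apply div_lt_div_of_pos_left ha0 hL0
        nlinarith
      _ = _ := by rw [ha, div_div]
  · have h1 : ε < 2 * t * gaussianPDFReal 0 1 t := by
      rw [hφ]
      calc ε = 2 * a * c ^ 2 := by rw [hεa]; ring
        _ < 2 * a * (1 / √π) := by
          gcongr
          rw [lt_div_iff₀ hp0]
          have h4 : Real.log 4 = 2 * Real.log 2 := by
            rw [show (4 : ℝ) = 2 ^ 2 by norm_num, Real.log_pow]; norm_num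
          have h5 := Real.log_two_gt_d9
          rw [h4] at hc4
          have h6 : c ^ 2 < 1 / 2 := by nlinarith
          nlinarith
        _ = 2 * (√2 * √L) * (a / (√2 * √π * √L)) := by field_simp
        _ ≤ _ := by gcongr
    linarith

theorem omegaRingEvent_subset {m n : ℕ} (hm : 0 < m) (x : Fin n → ℝ) {ε β t b : ℝ} (hb : b ≤ β) :
    omegaRingEvent m n x ε β ⊆ (fun (A : Fin m → Fin n → ℝ) i => ∑ j, A i j * x j) ⁻¹'
      ({y | b * m ≤ ∑ i, {z : ℝ | t < |z|}.indicator 1 (y i)} ∪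
        {y | (1 - ε) * m ≤ ∑ i, {z : ℝ | |z| ≤ t}.indicator (fun z => z ^ 2) (y i)}) := by
  intro A hA
  have hm' : (0 : ℝ) < m := by exact_mod_cast hm
  set y : Fin m → ℝ := fun i => ∑ j, A i j * x j with hy
  rw [Set.mem_preimage, Set.mem_union, or_iff_not_imp_left]
  simp only [Set.mem_ofPred_eq, not_le]
  intro h
  set T : Finset (Fin m) := Finset.univ.filter fun i => |y i| ≤ t with hT
  have hcard : (Tᶜ.card : ℝ) = ∑ i, {z : ℝ | t < |z|}.indicator 1 (y i) := by
    rw [hT, Finset.compl_filter, Finset.card_filter]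
    push_cast
    simp [Set.indicator_apply]
  have hsum : subNormSq A x T = ∑ i, {z : ℝ | |z| ≤ t}.indicator (fun z => z ^ 2) (y i) := by
    simp [subNormSq, hT, Finset.sum_filter, Set.indicator_apply, hy]
  have h1 := hA T (by
    rw [hcard]
    exact h.le.trans (mul_le_mul_of_nonneg_right hb hm'.le))
  have h2 := (abs_le.1 h1).1
  rw [← hsum]
  have h3 : 1 - ε ≤ subNormSq A x T / m := by
    rw [one_div, inv_mul_eq_div] at h2
    linarith
  exact (le_div_iff₀ hm').1 h3

/-- If the Gaussian tail mass beyond `t` is below `b` while the second moment within `t` is below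
`1 - ε`, then `P(Ω̊_{ε,β})` is eventually at most `1/2`, uniformly in `β ≥ b`. -/
theorem eventually_gaussianMatrix_omegaRingEvent_le_half {n : ℕ} (x : Fin n → ℝ)
    (hx : ∑ j, x j ^ 2 = 1) {ε t b : ℝ}
    (h1 : (gaussianReal 0 1).real {z | t < |z|} < b)
    (h2 : ∫ z, {z : ℝ | |z| ≤ t}.indicator (fun z => z ^ 2) z ∂(gaussianReal 0 1) < 1 - ε) :
    ∀ᶠ m : ℕ in Filter.atTop, ∀ β, b ≤ β →
      gaussianMatrix m n (omegaRingEvent m n x ε β) ≤ ENNReal.ofReal (1 / 2) := by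
  have hm1 : MeasurableSet {z : ℝ | t < |z|} := measurableSet_lt measurable_const measurable_abs
  have hm2 : MeasurableSet {z : ℝ | |z| ≤ t} := measurableSet_le measurable_abs measurable_const
  have hf1 : Measurable ({z : ℝ | t < |z|}.indicator (1 : ℝ → ℝ)) := measurable_one.indicator hm1
  have hf2 : Measurable ({z : ℝ | |z| ≤ t}.indicator fun z => z ^ 2) :=
    (by fun_prop : Measurable fun z : ℝ => z ^ 2).indicator hm2
  have l1 := tendsto_stdGaussianPi_sum_ge hf1 (K := 1) (b := b)
    (fun z => by by_cases hz : z ∈ {z : ℝ | t < |z|} <;> simp [hz])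
    (by rwa [integral_indicator_one hm1])
  have l2 := tendsto_stdGaussianPi_sum_ge hf2 (K := t ^ 2) (fun z => by
    by_cases hz : z ∈ {z : ℝ | |z| ≤ t}
    · rw [Set.indicator_of_mem hz, abs_of_nonneg (sq_nonneg z), ← sq_abs z]
      exact pow_le_pow_left₀ (abs_nonneg z) hz 2
    · simp [hz, sq_nonneg]) h2
  have l3 := l1.add l2
  rw [add_zero] at l3
  filter_upwards [l3.eventually (gt_mem_nhds (by norm_num : (0 : ℝ) < 1 / 2)),
    Filter.eventually_gt_atTop 0] with m hm hm0 β hβ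
  set S1 : Set (Fin m → ℝ) := {y | b * m ≤ ∑ i, {z : ℝ | t < |z|}.indicator 1 (y i)}
  set S2 : Set (Fin m → ℝ) :=
    {y | (1 - ε) * m ≤ ∑ i, {z : ℝ | |z| ≤ t}.indicator (fun z => z ^ 2) (y i)}
  have hS1 : MeasurableSet S1 := measurableSet_le measurable_const
    (Finset.measurable_sum _ fun i _ => hf1.comp (measurable_pi_apply i))
  have hS2 : MeasurableSet S2 := measurableSet_le measurable_const
    (Finset.measurable_sum _ fun i _ => hf2.comp (measurable_pi_apply i))
  calc gaussianMatrix m n (omegaRingEvent m n x ε β)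
      ≤ gaussianMatrix m n
        ((fun (A : Fin m → Fin n → ℝ) i => ∑ j, A i j * x j) ⁻¹' (S1 ∪ S2)) :=
        measure_mono (omegaRingEvent_subset hm0 x hβ)
    _ = stdGaussianPi m (S1 ∪ S2) :=
        (measurePreserving_mulVec_gaussianMatrix x hx).measure_preimage
          (hS1.union hS2).nullMeasurableSet
    _ ≤ ENNReal.ofReal (1 / 2) := by
        rw [← ofReal_measureReal]
        exact ENNReal.ofReal_le_ofReal ((measureReal_union_le S1 S2).trans hm.le)

theorem betaRingMaxC_upper_bound (n : ℕ) (x₀ : Fin n → ℝ) (hx₀ : ∑ j, x₀ j ^ 2 = 1)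
    (cg : ℝ) (hcg : 0 < cg) (hcgProp : cgProperty cg)
    (α C : ℝ) (hα : 0 < α) (hC : 0 < C)
    (ε : ℝ) (hε0 : 0 < ε) (hε1 : ε < min 1 (cg ^ 2 * Real.log 2)) :
    betaRingMaxC n x₀ ε α C < ε / (2 * cg ^ 2 * Real.log (2 * cg ^ 2 / ε)) := by
  obtain ⟨t, ht0, h1, h2⟩ := exists_threshold hcg (hcgProp.sq_mul_log_four_le hcg) hε0
    (hε1.trans_le (min_le_right _ _))
  obtain ⟨b, hb1, hb2⟩ := exists_between h1
  have hb0 : 0 ≤ b := measureReal_nonneg.trans hb1.le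
  have hε : ε < 1 := hε1.trans_le (min_le_left _ _)
  refine lt_of_le_of_lt (Real.sSup_le ?_ hb0) hb2
  rintro β ⟨-, -, M, hM⟩
  by_contra! hβ
  set κ := α * (ε ^ 2 / 4 - ε ^ 3 / 6)
  have hκ : 0 < κ := by
    refine mul_pos hα ?_
    nlinarith [pow_pos hε0 2]
  have hlim : Filter.Tendsto (fun m : ℕ => C * Real.exp (-(κ * m))) Filter.atTop (nhds 0) := by
    have := (Real.tendsto_exp_neg_atTop_nhds_zero.comp
      (tendsto_natCast_atTop_atTop.const_mul_atTop hκ)).const_mul C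
    simpa [Function.comp_def] using this
  obtain ⟨m, hm1, hm2, hm3⟩ := ((eventually_gaussianMatrix_omegaRingEvent_le_half x₀ hx₀ hb1 h2).and
    ((hlim.eventually (gt_mem_nhds (by norm_num : (0 : ℝ) < 1 / 2))).and
      (Filter.eventually_ge_atTop M))).exists
  have h := (hM m hm3).trans (hm1 β hβ.le)
  rw [ENNReal.ofReal_le_ofReal_iff (by norm_num),
    show -α * (ε ^ 2 / 4 - ε ^ 3 / 6) * m = -(κ * m) by ring] at h
  linarith
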